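/- arXiv:2507.14404 — 3 statements merged into one kernel-verified Lean document; each statement's English description precedes it below -/
import Mathlib

section
/- Let T = A∘B be a closed operator on H, where A ∈ L⁺(H) and B is a nonnegative selfadjoint operator (so T ∈ L²₊ and dom T = dom B). Then the operator S := A^{1/2}∘B∘A^{1/2} (with domain {x ∈ H : A^{1/2}x ∈ dom B}) is densely defined, selfadjoint and nonnegative, and T is pre-similar to S with intertwining operator A^{1/2}: the compositions T∘A^{1/2} and A^{1/2}∘S have the same domain (equal to dom S) and T(A^{1/2}x) = A^{1/2}(Sx) for all x ∈ dom S. -/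
open scoped ComplexOrder
noncomputable section

local notation "⟪" x ", " y "⟫" => @inner ℂ _ _ x y

section Toolkit

/-- Composition of partially defined linear maps:
`pcomp S T` has domain `{x ∈ dom T : T x ∈ dom S}` and maps `x ↦ S (T x)`. -/
def pcomp {R E F G : Type*} [CommRing R] [AddCommGroup E] [Module R E]
    [AddCommGroup F] [Module R F] [AddCommGroup G] [Module R G]
    (S : F →ₗ.[R] G) (T : E →ₗ.[R] F) : E →ₗ.[R] G where
  domain := (S.domain.comap T.toFun).map T.domain.subtype
  toFun := (S.toFun.comp (T.toFun.restrict (p := S.domain.comap T.toFun) (q := S.domain)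
      fun _ hx => hx)).comp
    (Submodule.equivMapOfInjective T.domain.subtype (Submodule.injective_subtype _)
      (S.domain.comap T.toFun)).symm.toLinearMap

/-- A bounded everywhere-defined operator viewed as a `LinearPMap` with domain `⊤`. -/
def ofCLM {E F : Type*} [NormedAddCommGroup E] [NormedAddCommGroup F]
    [NormedSpace ℂ E] [NormedSpace ℂ F] (X : E →L[ℂ] F) : E →ₗ.[ℂ] F :=
  (X : E →ₗ[ℂ] F).toPMap ⊤

variable {H : Type*} [NormedAddCommGroup H] [InnerProductSpace ℂ H] [CompleteSpace H]

/-- `B` is nonnegative selfadjoint: densely defined, `B* = B`, and `⟪Bx, x⟫ ≥ 0` on `dom B`. -/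
def IsNonnegSelfAdjoint (B : H →ₗ.[ℂ] H) : Prop :=
  Dense (B.domain : Set H) ∧ B.adjoint = B ∧ ∀ x : B.domain, 0 ≤ ⟪B x, (x : H)⟫

/-- `C` is a selfadjoint partial operator: densely defined with `C* = C`. -/
def IsSelfAdjointPMap (C : H →ₗ.[ℂ] H) : Prop :=
  Dense (C.domain : Set H) ∧ C.adjoint = C

/-- A quasi-affinity: an injective bounded everywhere-defined operator with dense range. -/
def IsQuasiAffinity (G : H →L[ℂ] H) : Prop :=
  Function.Injective G ∧ DenseRange G

end Toolkit

section Graphs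

theorem mem_graph_pcomp {R E F G : Type*} [CommRing R] [AddCommGroup E] [Module R E]
    [AddCommGroup F] [Module R F] [AddCommGroup G] [Module R G]
    {S : F →ₗ.[R] G} {T : E →ₗ.[R] F} {x : E} {z : G} :
    (x, z) ∈ (pcomp S T).graph ↔ ∃ y, (x, y) ∈ T.graph ∧ (y, z) ∈ S.graph := by
  have key (x : T.domain) (hx : T x ∈ S.domain) :
      (pcomp S T) ⟨x, Submodule.mem_map_of_mem (f := T.domain.subtype) hx⟩ = S ⟨T x, hx⟩ := by
    have : (Submodule.equivMapOfInjective T.domain.subtype (Submodule.injective_subtype _)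
        (S.domain.comap T.toFun)).symm
          ⟨x, Submodule.mem_map_of_mem (f := T.domain.subtype) hx⟩ = ⟨x, hx⟩ := by
      rw [LinearEquiv.symm_apply_eq]
      rfl
    exact congrArg (fun w => S ⟨T w.1, w.2⟩) this
  constructor
  · rw [LinearPMap.mem_graph_iff]
    rintro ⟨⟨_, x, hx, rfl⟩, rfl, hz⟩
    refine ⟨T x, T.mem_graph x, ?_⟩
    have hz : S ⟨T x, hx⟩ = z := (key x hx).symm.trans hz
    rw [← hz]
    exact S.mem_graph ⟨T x, hx⟩
  · rintro ⟨y, hxy, hyz⟩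
    rw [LinearPMap.mem_graph_iff] at hxy hyz
    obtain ⟨x, rfl, rfl⟩ := hxy
    obtain ⟨⟨y, hy⟩, hxy, hyz⟩ := hyz
    obtain rfl : y = T x := hxy
    obtain rfl : S ⟨T x, hy⟩ = z := hyz
    rw [← key x hy]
    exact (pcomp S T).mem_graph ⟨x, Submodule.mem_map_of_mem (f := T.domain.subtype) hy⟩

theorem mem_graph_ofCLM {E F : Type*} [NormedAddCommGroup E] [NormedAddCommGroup F]
    [NormedSpace ℂ E] [NormedSpace ℂ F] {X : E →L[ℂ] F} {x : E} {y : F} :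
    (x, y) ∈ (ofCLM X).graph ↔ X x = y := by
  rw [LinearPMap.mem_graph_iff]
  exact ⟨fun ⟨_, hx, hy⟩ => (congrArg X hx).symm.trans hy, fun h => ⟨⟨x, trivial⟩, rfl, h⟩⟩

theorem mem_graph_ofCLM_pcomp {E F G : Type*} [NormedAddCommGroup E] [NormedAddCommGroup F]
    [NormedAddCommGroup G] [NormedSpace ℂ E] [NormedSpace ℂ F] [NormedSpace ℂ G]
    {X : F →L[ℂ] G} {T : E →ₗ.[ℂ] F} {x : E} {z : G} :
    (x, z) ∈ (pcomp (ofCLM X) T).graph ↔ ∃ y, (x, y) ∈ T.graph ∧ X y = z := by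
  simp only [mem_graph_pcomp, mem_graph_ofCLM]

theorem mem_graph_pcomp_ofCLM {E F G : Type*} [NormedAddCommGroup E] [NormedAddCommGroup F]
    [NormedAddCommGroup G] [NormedSpace ℂ E] [NormedSpace ℂ F] [NormedSpace ℂ G]
    {X : E →L[ℂ] F} {T : F →ₗ.[ℂ] G} {x : E} {z : G} :
    (x, z) ∈ (pcomp T (ofCLM X)).graph ↔ (X x, z) ∈ T.graph := by
  simp only [mem_graph_pcomp, mem_graph_ofCLM, exists_eq_left']

end Graphs

section HilbertSpace

variable {H : Type*} [NormedAddCommGroup H] [InnerProductSpace ℂ H]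
  {B : H →ₗ.[ℂ] H} {G : H →L[ℂ] H}

/-- If `G ∘ G ∘ B` is closed, with `G` bounded selfadjoint, then so is `G ∘ B`. -/
theorem isClosed_ofCLM_pcomp (hG : (G : H →ₗ[ℂ] H).IsSymmetric)
    (h : (pcomp (ofCLM (G ∘L G)) B).IsClosed) : (pcomp (ofCLM G) B).IsClosed := by
  have heq : ((pcomp (ofCLM G) B).graph : Set (H × H)) =
      (fun p : H × H => (p.1, G p.2)) ⁻¹' ((pcomp (ofCLM (G ∘L G)) B).graph : Set (H × H)) ∩
        Prod.snd ⁻¹' ((G : H →ₗ[ℂ] H).kerᗮ : Set H) := by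
    ext ⟨x, z⟩
    simp only [SetLike.mem_coe, Set.mem_inter_iff, Set.mem_preimage, mem_graph_ofCLM_pcomp,
      Submodule.mem_orthogonal]
    constructor
    · rintro ⟨b, hb, rfl⟩
      refine ⟨⟨b, hb, rfl⟩, fun n hn => ?_⟩
      have hn : G n = 0 := hn
      rw [← ContinuousLinearMap.coe_coe, ← hG n b, ContinuousLinearMap.coe_coe, hn, inner_zero_left]
    · rintro ⟨⟨b, hb, hbz⟩, hz⟩
      refine ⟨b, hb, ?_⟩
      have hker : G (G b - z) = 0 := by
        rw [map_sub, sub_eq_zero]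
        exact hbz
      have h1 : ⟪G b - z, z⟫ = 0 := hz _ hker
      have h2 : ⟪G b - z, G b⟫ = 0 := by
        rw [← ContinuousLinearMap.coe_coe, ← hG, ContinuousLinearMap.coe_coe, hker, inner_zero_left]
      rw [← sub_eq_zero, ← inner_self_eq_zero (𝕜 := ℂ), inner_sub_right, h1, h2, sub_zero]
  rw [LinearPMap.IsClosed, heq]
  exact (IsClosed.preimage (by fun_prop) h).inter
    ((Submodule.isClosed_orthogonal _).preimage continuous_snd)

variable [CompleteSpace H]

theorem adjoint_adjoint_le_of_isClosed {g : Submodule ℂ (H × H)} (hg : IsClosed (g : Set (H × H))) :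
    g.adjoint.adjoint ≤ g := by
  let e := WithLp.linearEquiv 2 ℂ (H × H)
  let K : Submodule ℂ (WithLp 2 (H × H)) := g.comap (e : WithLp 2 (H × H) →ₗ[ℂ] H × H)
  have hK : IsClosed (K : Set (WithLp 2 (H × H))) :=
    hg.preimage (WithLp.prod_continuous_ofLp 2 H H)
  have : CompleteSpace K := hK.completeSpace_coe
  rintro ⟨u, z⟩ huz
  rw [Submodule.mem_adjoint_iff] at huz
  suffices h : WithLp.toLp 2 (u, z) ∈ Kᗮᗮ by
    rw [Submodule.orthogonal_orthogonal] at h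
    exact h
  rw [Submodule.mem_orthogonal]
  intro p hp
  rw [Submodule.mem_orthogonal] at hp
  have hadj : (p.snd, -p.fst) ∈ g.adjoint := by
    rw [Submodule.mem_adjoint_iff]
    intro a b hab
    have := hp (WithLp.toLp 2 (a, b)) hab
    rw [WithLp.prod_inner_apply] at this
    simp only [inner_neg_right, sub_neg_eq_add]
    rw [add_comm]
    exact this
  have := huz _ _ hadj
  rw [inner_neg_left] at this
  rw [WithLp.prod_inner_apply]
  change ⟪p.fst, u⟫ + ⟪p.snd, z⟫ = 0
  linear_combination -this

theorem IsNonnegSelfAdjoint.mem_graph_iff (hB : IsNonnegSelfAdjoint B) {u v : H} :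
    (u, v) ∈ B.graph ↔ ∀ x y, (x, y) ∈ B.graph → ⟪y, u⟫ = ⟪x, v⟫ := by
  conv_lhs => rw [← hB.2.1, LinearPMap.adjoint_graph_eq_graph_adjoint hB.1]
  simp only [Submodule.mem_adjoint_iff, sub_eq_zero]

theorem mem_adjoint_graph_ofCLM_pcomp_iff (hB : IsNonnegSelfAdjoint B)
    (hG : (G : H →ₗ[ℂ] H).IsSymmetric) {y w : H} :
    (y, w) ∈ (pcomp (ofCLM G) B).graph.adjoint ↔ (G y, w) ∈ B.graph := by
  rw [hB.mem_graph_iff, Submodule.mem_adjoint_iff]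
  simp only [sub_eq_zero, mem_graph_ofCLM_pcomp]
  constructor
  · intro h x b hb
    rw [← h x (G b) ⟨b, hb, rfl⟩]
    exact (hG b y).symm
  · rintro h x _ ⟨b, hb, rfl⟩
    rw [← h x b hb]
    exact hG b y

theorem isNonnegSelfAdjoint_conj (hB : IsNonnegSelfAdjoint B)
    (hG : (G : H →ₗ[ℂ] H).IsSymmetric) (hcl : (pcomp (ofCLM G) B).IsClosed) :
    IsNonnegSelfAdjoint (pcomp (pcomp (ofCLM G) B) (ofCLM G)) := by
  set S := pcomp (pcomp (ofCLM G) B) (ofCLM G) with hS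
  have mem_S {x z : H} : (x, z) ∈ S.graph ↔ ∃ b, (G x, b) ∈ B.graph ∧ G b = z := by
    rw [hS, mem_graph_pcomp_ofCLM, mem_graph_ofCLM_pcomp]
  have biadjoint {u z : H} (h : ∀ x b, (G x, b) ∈ B.graph → ⟪b, u⟫ = ⟪x, z⟫) :
      ∃ b, (u, b) ∈ B.graph ∧ G b = z := by
    rw [← mem_graph_ofCLM_pcomp]
    apply adjoint_adjoint_le_of_isClosed hcl
    rw [Submodule.mem_adjoint_iff]
    intro x b hxb
    rw [mem_adjoint_graph_ofCLM_pcomp_iff hB hG] at hxb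
    exact sub_eq_zero.2 (h x b hxb)
  have hdense : Dense (S.domain : Set H) := by
    rw [Submodule.dense_iff_topologicalClosure_eq_top,
      Submodule.topologicalClosure_eq_top_iff, Submodule.eq_bot_iff]
    intro z hz
    rw [Submodule.mem_orthogonal] at hz
    obtain ⟨b, hb, rfl⟩ := biadjoint (u := 0) (z := z) fun x b hb => by
      rw [inner_zero_right, hz x (LinearPMap.mem_domain_of_mem_graph (mem_S.2 ⟨b, hb, rfl⟩))]
    rw [B.graph_fst_eq_zero_snd hb rfl, map_zero]
  refine ⟨hdense, LinearPMap.eq_of_eq_graph ?_, fun x => ?_⟩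
  · rw [LinearPMap.adjoint_graph_eq_graph_adjoint hdense]
    ext ⟨y, w⟩
    rw [mem_S, Submodule.mem_adjoint_iff]
    simp only [sub_eq_zero, mem_S]
    constructor
    · intro h
      refine biadjoint fun x b hb => ?_
      rw [← h x (G b) ⟨b, hb, rfl⟩]
      exact (hG b y).symm
    · rintro ⟨c, hc, rfl⟩ x _ ⟨b, hb, rfl⟩
      calc ⟪G b, y⟫ = ⟪b, G y⟫ := hG b y
        _ = ⟪G x, c⟫ := hB.mem_graph_iff.1 hc _ _ hb
        _ = ⟪x, G c⟫ := hG x c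
  · obtain ⟨b, hb, hbx⟩ := mem_S.1 (S.mem_graph x)
    rw [← hbx, show ⟪G b, (x : H)⟫ = ⟪b, G x⟫ from hG b x]
    obtain ⟨v, hv, rfl⟩ := (LinearPMap.mem_graph_iff B).1 hb
    rw [← show (v : H) = G x from hv]
    exact hB.2.2 v

end HilbertSpace

/-- For `T = A ∘ B ∈ L²₊` closed, with `A ∈ L⁺(H)` and `B` nonnegative selfadjoint,
the operator `S = A^{1/2} ∘ B ∘ A^{1/2}` is densely defined, nonnegative selfadjoint, and `T` is
pre-similar to `S` with intertwining operator `A^{1/2}`, i.e. `T ∘ A^{1/2} = A^{1/2} ∘ S` with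
common domain `dom S`. -/
theorem statement2
    {H : Type*} [NormedAddCommGroup H] [InnerProductSpace ℂ H] [CompleteSpace H]
    (A : H →L[ℂ] H) (hA : A.IsPositive)
    (B : H →ₗ.[ℂ] H) (hB : IsNonnegSelfAdjoint B)
    (hT : (pcomp (ofCLM A) B).IsClosed)
    (Ah : H →L[ℂ] H) (hAh : Ah = cfc Real.sqrt A)
    (S : H →ₗ.[ℂ] H) (hS : S = pcomp (pcomp (ofCLM Ah) B) (ofCLM Ah)) :
    IsNonnegSelfAdjoint S ∧
    pcomp (pcomp (ofCLM A) B) (ofCLM Ah) = pcomp (ofCLM Ah) S ∧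
    (pcomp (pcomp (ofCLM A) B) (ofCLM Ah)).domain = S.domain := by
  have hG : IsSelfAdjoint Ah := hAh ▸ cfc_predicate Real.sqrt A
  have hGsymm : (Ah : H →ₗ[ℂ] H).IsSymmetric := hG.isSymmetric
  have hGG : A = Ah ∘L Ah := by
    have h0 : 0 ≤ A := (ContinuousLinearMap.nonneg_iff_isPositive A).2 hA
    change A = Ah * Ah
    rw [hAh, ← cfc_mul Real.sqrt Real.sqrt A]
    conv_lhs => rw [← cfc_id' ℝ A]
    exact cfc_congr fun x hx => (Real.mul_self_sqrt (spectrum_nonneg_of_nonneg h0 hx)).symm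
  subst hGG hS
  have hgraph : pcomp (pcomp (ofCLM (Ah ∘L Ah)) B) (ofCLM Ah) =
      pcomp (ofCLM Ah) (pcomp (pcomp (ofCLM Ah) B) (ofCLM Ah)) := by
    apply LinearPMap.eq_of_eq_graph
    ext ⟨x, z⟩
    simp only [mem_graph_pcomp_ofCLM, mem_graph_ofCLM_pcomp]
    constructor
    · rintro ⟨b, hb, rfl⟩
      exact ⟨Ah b, ⟨b, hb, rfl⟩, rfl⟩
    · rintro ⟨_, ⟨b, hb, rfl⟩, rfl⟩
      exact ⟨b, hb, rfl⟩
  refine ⟨isNonnegSelfAdjoint_conj hB hGsymm (isClosed_ofCLM_pcomp hGsymm hT), hgraph, ?_⟩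
  rw [hgraph]
  ext x
  simp only [LinearPMap.mem_domain_iff, mem_graph_ofCLM_pcomp]
  exact ⟨fun ⟨_, y, hy, _⟩ => ⟨y, hy⟩, fun ⟨y, hy⟩ => ⟨_, y, hy, rfl⟩⟩
end
end

section
/- Let T and B be closed densely defined operators from H to K such that the operator T*∘B (with domain {x ∈ dom B : Bx ∈ dom T*}, x ↦ T*(Bx)) is selfadjoint, and suppose Y ∈ L⁺(K) satisfies Y∘B ⊆ T, i.e. dom B ⊆ dom T and Tx = Y(Bx) for all x ∈ dom B. Then T*∘B = B*∘Y∘B = B*∘T (equalities of partial operators, where B*∘Y∘B has domain {x ∈ dom B : Y(Bx) ∈ dom B*} and B*∘T has domain {x ∈ dom T : Tx ∈ dom B*}), and for every x ∈ dom B the number ⟨Bx, Tx⟩ is real and nonnegative with ‖Tx‖² ≤ ‖Y‖·⟨Bx, Tx⟩ ≤ ‖Y‖²·‖Bx‖². -/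
open scoped ComplexOrder
noncomputable section

local notation "⟪" x ", " y "⟫" => @inner ℂ _ _ x y

theorem mem_graph_pcomp_iff {R E F G : Type*} [CommRing R] [AddCommGroup E] [Module R E]
    [AddCommGroup F] [Module R F] [AddCommGroup G] [Module R G]
    (S : F →ₗ.[R] G) (T : E →ₗ.[R] F) (x : E) (z : G) :
    (x, z) ∈ (pcomp S T).graph ↔ ∃ y, (x, y) ∈ T.graph ∧ (y, z) ∈ S.graph := by
  have key : ∀ (x : T.domain) (hx : T x ∈ S.domain) (h : (x : E) ∈ (pcomp S T).domain),
      pcomp S T ⟨x, h⟩ = S ⟨T x, hx⟩ := by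
    intro x hx h
    have he : (Submodule.equivMapOfInjective T.domain.subtype (Submodule.injective_subtype _)
        (S.domain.comap T.toFun)).symm ⟨x, h⟩ = ⟨x, hx⟩ := by
      rw [LinearEquiv.symm_apply_eq]
      rfl
    change S.toFun ((T.toFun.restrict (p := S.domain.comap T.toFun) (q := S.domain)
      fun _ hx => hx) ((Submodule.equivMapOfInjective T.domain.subtype
        (Submodule.injective_subtype _) (S.domain.comap T.toFun)).symm ⟨x, h⟩)) = _
    rw [he]
    rfl
  constructor
  · intro h
    obtain ⟨⟨w, hw⟩, rfl, rfl⟩ := (LinearPMap.mem_graph_iff _).1 h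
    obtain ⟨x, hx, rfl⟩ := id hw
    exact ⟨T x, T.mem_graph x,
      (LinearPMap.mem_graph_iff _).2 ⟨⟨T x, hx⟩, rfl, (key x hx hw).symm⟩⟩
  · rintro ⟨y, hxy, hyz⟩
    obtain ⟨x, rfl, rfl⟩ := (LinearPMap.mem_graph_iff _).1 hxy
    obtain ⟨⟨y, hy⟩, h₁, rfl⟩ := (LinearPMap.mem_graph_iff _).1 hyz
    obtain rfl : y = T x := h₁
    have h : (x : E) ∈ (pcomp S T).domain := ⟨x, hy, rfl⟩
    exact (LinearPMap.mem_graph_iff _).2 ⟨⟨x, h⟩, rfl, key x hy h⟩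

theorem pcomp_mono_right {R E F G : Type*} [CommRing R] [AddCommGroup E] [Module R E]
    [AddCommGroup F] [Module R F] [AddCommGroup G] [Module R G]
    (S : F →ₗ.[R] G) {T T' : E →ₗ.[R] F} (h : T ≤ T') : pcomp S T ≤ pcomp S T' := by
  refine LinearPMap.le_of_le_graph fun ⟨x, z⟩ hxz => ?_
  rw [mem_graph_pcomp_iff] at hxz ⊢
  obtain ⟨y, hy, hyz⟩ := hxz
  exact ⟨y, LinearPMap.le_graph_of_le h hy, hyz⟩

theorem mem_graph_ofCLM_iff {E F : Type*} [NormedAddCommGroup E] [NormedAddCommGroup F]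
    [NormedSpace ℂ E] [NormedSpace ℂ F] (X : E →L[ℂ] F) (x : E) (y : F) :
    (x, y) ∈ (ofCLM X).graph ↔ X x = y := by
  rw [LinearPMap.mem_graph_iff]
  constructor
  · rintro ⟨x, rfl, rfl⟩
    rfl
  · rintro rfl
    exact ⟨⟨x, trivial⟩, rfl, rfl⟩

theorem mem_graph_adjoint_iff {E F : Type*} [NormedAddCommGroup E] [InnerProductSpace ℂ E]
    [CompleteSpace E] [NormedAddCommGroup F] [InnerProductSpace ℂ F]
    {T : E →ₗ.[ℂ] F} (hT : Dense (T.domain : Set E)) (y : F) (z : E) :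
    (y, z) ∈ T.adjoint.graph ↔ ∀ a b, (a, b) ∈ T.graph → ⟪b, y⟫ = ⟪a, z⟫ := by
  rw [LinearPMap.adjoint_graph_eq_graph_adjoint hT, Submodule.mem_adjoint_iff]
  simp only [sub_eq_zero]

/-- `B* ∘ T` is contained in the adjoint of `T* ∘ B`. -/
theorem pcomp_adjoint_le_adjoint_pcomp {E F : Type*}
    [NormedAddCommGroup E] [InnerProductSpace ℂ E] [CompleteSpace E]
    [NormedAddCommGroup F] [InnerProductSpace ℂ F]
    {T B : E →ₗ.[ℂ] F} (hT : Dense (T.domain : Set E)) (hB : Dense (B.domain : Set E))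
    (h : Dense ((pcomp T.adjoint B).domain : Set E)) :
    pcomp B.adjoint T ≤ (pcomp T.adjoint B).adjoint := by
  refine LinearPMap.le_of_le_graph fun ⟨x, z⟩ hxz => ?_
  obtain ⟨y, hxy, hyz⟩ := (mem_graph_pcomp_iff _ _ _ _).1 hxz
  refine (mem_graph_adjoint_iff h x z).2 fun a c hac => ?_
  obtain ⟨b, hab, hbc⟩ := (mem_graph_pcomp_iff _ _ _ _).1 hac
  have h₁ := (mem_graph_adjoint_iff hB y z).1 hyz a b hab
  have h₂ := (mem_graph_adjoint_iff hT b c).1 hbc x y hxy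
  rw [← h₁, ← inner_conj_symm, ← h₂, inner_conj_symm]

/-- If `Y` is symmetric and `Y ∘ B ⊆ T`, then `T* ∘ B ⊆ B* ∘ Y ∘ B`. -/
theorem pcomp_adjoint_le_pcomp_adjoint_pcomp_ofCLM {E F : Type*}
    [NormedAddCommGroup E] [InnerProductSpace ℂ E] [CompleteSpace E]
    [NormedAddCommGroup F] [InnerProductSpace ℂ F]
    {T B : E →ₗ.[ℂ] F} (hT : Dense (T.domain : Set E)) (hB : Dense (B.domain : Set E))
    {Y : F →L[ℂ] F} (hY : (Y : F →ₗ[ℂ] F).IsSymmetric) (h : pcomp (ofCLM Y) B ≤ T) :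
    pcomp T.adjoint B ≤ pcomp B.adjoint (pcomp (ofCLM Y) B) := by
  have hYB : ∀ a b, (a, b) ∈ B.graph → (a, Y b) ∈ (pcomp (ofCLM Y) B).graph := fun a b hab =>
    (mem_graph_pcomp_iff _ _ _ _).2 ⟨b, hab, (mem_graph_ofCLM_iff Y b _).2 rfl⟩
  refine LinearPMap.le_of_le_graph fun ⟨x, z⟩ hxz => ?_
  obtain ⟨y, hxy, hyz⟩ := (mem_graph_pcomp_iff _ _ _ _).1 hxz
  refine (mem_graph_pcomp_iff _ _ _ _).2 ⟨Y y, hYB x y hxy, ?_⟩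
  refine (mem_graph_adjoint_iff hB _ _).2 fun a b hab => ?_
  rw [← (mem_graph_adjoint_iff hT y z).1 hyz a (Y b) (LinearPMap.le_graph_of_le h (hYB a b hab))]
  exact (hY b y).symm

theorem ContinuousLinearMap.IsPositive.norm_apply_sq_le {F : Type*} [NormedAddCommGroup F]
    [InnerProductSpace ℂ F] [CompleteSpace F] {Y : F →L[ℂ] F} (hY : Y.IsPositive) (u : F) :
    ‖Y u‖ ^ 2 ≤ ‖Y‖ * (⟪u, Y u⟫).re := by
  obtain ⟨S, rfl⟩ := CStarAlgebra.nonneg_iff_eq_star_mul_self.1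
    ((ContinuousLinearMap.nonneg_iff_isPositive Y).2 hY)
  have h₁ : (⟪u, (star S * S) u⟫).re = ‖S u‖ ^ 2 := by
    rw [mul_apply_eq_comp, ContinuousLinearMap.star_eq_adjoint,
      ContinuousLinearMap.adjoint_inner_right]
    exact inner_self_eq_norm_sq (𝕜 := ℂ) (S u)
  have h₂ : ‖(star S * S) u‖ ≤ ‖S‖ * ‖S u‖ := by
    rw [mul_apply_eq_comp, ← norm_star S]
    exact (star S).le_opNorm (S u)
  rw [h₁, CStarRing.norm_star_mul_self, ← sq, ← mul_pow]
  gcongr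

/-- If `T, B : H → K` are closed densely defined with `T* ∘ B` selfadjoint and
`Y ∈ L⁺(K)` satisfies `Y ∘ B ⊆ T`, then `T* ∘ B = B* ∘ Y ∘ B = B* ∘ T` and for `x ∈ dom B`
the number `⟪Bx, Tx⟫` is real nonnegative with `‖Tx‖² ≤ ‖Y‖·⟪Bx, Tx⟫ ≤ ‖Y‖²·‖Bx‖²`. -/
theorem statement5
    {H K : Type*} [NormedAddCommGroup H] [InnerProductSpace ℂ H] [CompleteSpace H]
    [NormedAddCommGroup K] [InnerProductSpace ℂ K] [CompleteSpace K]
    (T B : H →ₗ.[ℂ] K) (hT : T.IsClosed) (hB : B.IsClosed)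
    (hTd : Dense (T.domain : Set H)) (hBd : Dense (B.domain : Set H))
    (hsa : IsSelfAdjointPMap (pcomp T.adjoint B))
    (Y : K →L[ℂ] K) (hY : Y.IsPositive)
    (hsub : B.domain ≤ T.domain)
    (hYB : ∀ x : B.domain, T ⟨(x : H), hsub x.2⟩ = Y (B x)) :
    pcomp T.adjoint B = pcomp B.adjoint (pcomp (ofCLM Y) B) ∧
    pcomp T.adjoint B = pcomp B.adjoint T ∧
    ∀ x : B.domain,
      0 ≤ ⟪B x, T ⟨(x : H), hsub x.2⟩⟫ ∧
      ‖T ⟨(x : H), hsub x.2⟩‖ ^ 2 ≤ ‖Y‖ * (⟪B x, T ⟨(x : H), hsub x.2⟩⟫).re ∧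
      ‖Y‖ * (⟪B x, T ⟨(x : H), hsub x.2⟩⟫).re ≤ ‖Y‖ ^ 2 * ‖B x‖ ^ 2 := by
  have hle : pcomp (ofCLM Y) B ≤ T := by
    refine LinearPMap.le_of_le_graph fun ⟨x, z⟩ hxz => ?_
    obtain ⟨y, hxy, hyz⟩ := (mem_graph_pcomp_iff _ _ _ _).1 hxz
    obtain ⟨x, rfl, rfl⟩ := (LinearPMap.mem_graph_iff _).1 hxy
    obtain rfl := (mem_graph_ofCLM_iff Y _ _).1 hyz
    exact (LinearPMap.mem_graph_iff _).2 ⟨⟨x, hsub x.2⟩, rfl, hYB x⟩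
  have h₁ : pcomp T.adjoint B ≤ pcomp B.adjoint (pcomp (ofCLM Y) B) :=
    pcomp_adjoint_le_pcomp_adjoint_pcomp_ofCLM hTd hBd hY.isSymmetric hle
  have h₂ : pcomp B.adjoint (pcomp (ofCLM Y) B) ≤ pcomp B.adjoint T := pcomp_mono_right _ hle
  have h₃ : pcomp B.adjoint T ≤ pcomp T.adjoint B :=
    (pcomp_adjoint_le_adjoint_pcomp hTd hBd hsa.1).trans_eq hsa.2
  refine ⟨le_antisymm h₁ (h₂.trans h₃), le_antisymm (h₁.trans h₂) h₃, fun x => ?_⟩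
  rw [hYB x]
  refine ⟨hY.inner_nonneg_right (B x), hY.norm_apply_sq_le (B x), ?_⟩
  calc ‖Y‖ * (⟪B x, Y (B x)⟫).re ≤ ‖Y‖ * (‖B x‖ * (‖Y‖ * ‖B x‖)) := by
        gcongr
        exact (re_inner_le_norm (𝕜 := ℂ) (B x) (Y (B x))).trans
          (mul_le_mul_of_nonneg_left (Y.le_opNorm _) (norm_nonneg _))
    _ = ‖Y‖ ^ 2 * ‖B x‖ ^ 2 := by ring
end
end

section
/- Let T be a closed densely defined operator on H with dense range. Then the following are equivalent: (i) there exist λ ≥ 0 and a nonnegative selfadjoint operator B on H such that T*∘B (domain {x ∈ dom B : Bx ∈ dom T*}) is selfadjoint, dom B ⊆ dom T ⊆ dom(closure(B restricted to dom(T*∘B))), and ‖Tx‖² ≤ λ·Re⟨Bx, Tx⟩ for all x ∈ dom(T*∘B); (ii) there exist A ∈ L⁺(H) with dense range and a nonnegative selfadjoint operator B with B = closure(B restricted to dom(T*∘B)) such that T = A∘B (in particular T ∈ L²₊). -/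
open scoped ComplexOrder
noncomputable section

local notation "⟪" x ", " y "⟫" => @inner ℂ _ _ x y

section Extension

variable {H : Type*} [NormedAddCommGroup H] [InnerProductSpace ℂ H] [CompleteSpace H]

/-- If the inner product of `D` is `⟪b x, t y⟫` and `t` is bounded for it, then some positive
operator on `H` maps `b x` to `t x`. -/
lemma exists_isPositive_apply_eq_of_inner_eq {D : Type*} [SeminormedAddCommGroup D]
    [InnerProductSpace ℂ D] (b t : D →ₗ[ℂ] H) (hin : ∀ x y : D, inner ℂ x y = ⟪b x, t y⟫)
    {c : ℝ} (hc : ∀ x, ‖t x‖ ≤ c * ‖x‖) :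
    ∃ A : H →L[ℂ] H, A.IsPositive ∧ ∀ x, A (b x) = t x := by
  let e : D →L[ℂ] UniformSpace.Completion D := UniformSpace.Completion.toComplL
  have he : DenseRange e := UniformSpace.Completion.denseRange_coe
  let V : UniformSpace.Completion D →L[ℂ] H := (t.mkContinuous c hc).extend e
  have hV : ∀ x : D, V (e x) = t x := fun x =>
    ContinuousLinearMap.extend_eq _ he (UniformSpace.Completion.isUniformInducing_coe D) x
  refine ⟨V ∘L V.adjoint, V.isPositive_self_comp_adjoint, fun x => ?_⟩
  have hadj : V.adjoint (b x) = e x := by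
    refine he.eq_of_inner_left ℂ fun y => ?_
    rw [ContinuousLinearMap.adjoint_inner_left, hV]
    exact (hin x y).symm.trans (UniformSpace.Completion.inner_coe x y).symm
  rw [ContinuousLinearMap.comp_apply, hadj, hV]

/-- The operator `b x ↦ t x`, whose domain need not be dense, has a positive bounded extension. -/
lemma exists_isPositive_apply_eq {D : Type*} [AddCommGroup D] [Module ℂ D]
    (b t : D →ₗ[ℂ] H) (hsymm : ∀ x y, ⟪b x, t y⟫ = ⟪t x, b y⟫) {c : ℝ} (hc : 0 ≤ c)
    (h : ∀ x, ‖t x‖ ^ 2 ≤ c * (⟪b x, t x⟫).re) :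
    ∃ A : H →L[ℂ] H, A.IsPositive ∧ ∀ x, A (b x) = t x := by
  have hpos : ∀ x, 0 ≤ (⟪b x, t x⟫).re := fun x => by
    rcases hc.eq_or_lt with rfl | hc
    · have : t x = 0 := by simpa using (h x)
      simp [this]
    · exact nonneg_of_mul_nonneg_right ((sq_nonneg _).trans (h x)) hc
  let core : PreInnerProductSpace.Core ℂ D :=
    { inner := fun x y => ⟪b x, t y⟫
      conj_inner_symm := fun x y => by rw [inner_conj_symm, hsymm]
      re_inner_nonneg := hpos
      add_left := fun x y z => by simp
      smul_left := fun x y r => by simp [mul_comm] }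
  let _ : SeminormedAddCommGroup D := InnerProductSpace.Core.toSeminormedAddCommGroup (c := core)
  let _ : InnerProductSpace ℂ D := InnerProductSpace.ofCore core
  have hnorm : ∀ x : D, ‖x‖ ^ 2 = (⟪b x, t x⟫).re := fun x =>
    norm_sq_eq_re_inner (𝕜 := ℂ) x
  refine exists_isPositive_apply_eq_of_inner_eq b t (fun _ _ => rfl) (c := √c) fun x => ?_
  refine abs_le_of_sq_le_sq' ?_ (by positivity) |>.2
  rw [mul_pow, Real.sq_sqrt hc, hnorm]
  exact h x

end Extension

section Graph

variable {H : Type*} [NormedAddCommGroup H] [InnerProductSpace ℂ H]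

lemma mem_pcomp_domain_iff {S T : H →ₗ.[ℂ] H} {x : H} :
    x ∈ (pcomp S T).domain ↔ ∃ h : x ∈ T.domain, T ⟨x, h⟩ ∈ S.domain := by
  simp only [pcomp, Submodule.mem_map, Submodule.mem_comap, Submodule.subtype_apply,
    Subtype.exists, exists_and_right, exists_eq_right]
  rfl

lemma pcomp_apply {S T : H →ₗ.[ℂ] H} (x : (pcomp S T).domain) (h : (x : H) ∈ T.domain)
    (h' : T ⟨x, h⟩ ∈ S.domain) : pcomp S T x = S ⟨T ⟨x, h⟩, h'⟩ := by
  have key : (Submodule.equivMapOfInjective T.domain.subtype (Submodule.injective_subtype _)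
      (S.domain.comap T.toFun)).symm x = ⟨⟨x, h⟩, h'⟩ := by
    exact (LinearEquiv.symm_apply_eq _).2 (Subtype.ext rfl)
  change S.toFun (T.toFun.restrict _ ((Submodule.equivMapOfInjective T.domain.subtype
    (Submodule.injective_subtype _) (S.domain.comap T.toFun)).symm x)) = _
  rw [key]
  rfl

lemma mem_pcomp_graph_iff {S T : H →ₗ.[ℂ] H} {x z : H} :
    (x, z) ∈ (pcomp S T).graph ↔ ∃ y, (x, y) ∈ T.graph ∧ (y, z) ∈ S.graph := by
  constructor
  · intro hx
    obtain ⟨⟨x, hxd⟩, rfl, rfl⟩ := (LinearPMap.mem_graph_iff _).1 hx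
    obtain ⟨h, h'⟩ := mem_pcomp_domain_iff.1 hxd
    refine ⟨T ⟨x, h⟩, T.mem_graph ⟨x, h⟩, ?_⟩
    rw [pcomp_apply _ h h']
    exact S.mem_graph ⟨_, h'⟩
  · rintro ⟨y, hxy, hyz⟩
    obtain ⟨⟨x, h⟩, rfl, rfl⟩ := (LinearPMap.mem_graph_iff _).1 hxy
    obtain ⟨⟨_, h'⟩, hy, rfl⟩ := (LinearPMap.mem_graph_iff _).1 hyz
    dsimp only at hy h'
    subst hy
    have := (pcomp S T).mem_graph ⟨x, mem_pcomp_domain_iff.2 ⟨h, h'⟩⟩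
    rwa [pcomp_apply _ h h'] at this

lemma mem_domRestrict_graph_iff {S : H →ₗ.[ℂ] H} {D : Submodule ℂ H} {x y : H} :
    (x, y) ∈ (S.domRestrict D).graph ↔ x ∈ D ∧ (x, y) ∈ S.graph := by
  constructor
  · intro h
    have h' := LinearPMap.le_graph_of_le LinearPMap.domRestrict_le h
    exact ⟨(LinearPMap.mem_domain_of_mem_graph h).1, h'⟩
  · rintro ⟨hx, h⟩
    obtain ⟨⟨x, hxS⟩, rfl, rfl⟩ := (LinearPMap.mem_graph_iff _).1 h
    refine (LinearPMap.mem_graph_iff _).2 ⟨⟨x, hx, hxS⟩, rfl, ?_⟩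
    exact LinearPMap.domRestrict_apply rfl

lemma graph_eq_topologicalClosure_of_eq_closure {B : H →ₗ.[ℂ] H} {D : Submodule ℂ H}
    (hB : B.IsClosed) (h : B = (B.domRestrict D).closure) :
    B.graph = (B.domRestrict D).graph.topologicalClosure := by
  rw [(hB.isClosable.leIsClosable LinearPMap.domRestrict_le).graph_closure_eq_closure_graph, ← h]

variable [CompleteSpace H]

lemma mem_adjoint_graph_iff {S : H →ₗ.[ℂ] H} (hS : Dense (S.domain : Set H)) {u w : H} :
    (u, w) ∈ S.adjoint.graph ↔ ∀ x y, (x, y) ∈ S.graph → ⟪w, x⟫ = ⟪u, y⟫ := by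
  rw [LinearPMap.adjoint_graph_eq_graph_adjoint hS, Submodule.mem_adjoint_iff]
  refine forall₃_congr fun x y _ => ?_
  rw [sub_eq_zero, ← inner_conj_symm w x, ← inner_conj_symm u y,
    (starRingEnd ℂ).injective.eq_iff, eq_comm]

/-- A densely defined symmetric operator `C` with `1 + C` surjective is selfadjoint. -/
lemma adjoint_eq_self_of_add_surjective {C : H →ₗ.[ℂ] H} (hC : Dense (C.domain : Set H))
    (hsymm : C ≤ C.adjoint) (hsurj : ∀ z, ∃ x y, (x, y) ∈ C.graph ∧ x + y = z) :
    C.adjoint = C := by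
  refine le_antisymm (LinearPMap.le_of_le_graph ?_) hsymm
  rintro ⟨u, w⟩ huw
  obtain ⟨x, y, hxy, hsum⟩ := hsurj (u + w)
  have hxy' := LinearPMap.le_graph_of_le hsymm hxy
  have hu : u - x = 0 := by
    obtain ⟨p, q, hpq, hp⟩ := hsurj (u - x)
    have h1 := (mem_adjoint_graph_iff hC).1 huw p q hpq
    have h2 := (mem_adjoint_graph_iff hC).1 hxy' p q hpq
    have h3 : ⟪w - y, p⟫ = ⟪u - x, q⟫ := by rw [inner_sub_left, inner_sub_left, h1, h2]
    have h4 : w - y = -(u - x) := by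
      rw [neg_sub, sub_eq_sub_iff_add_eq_add, add_comm w u, ← hsum]
    rw [h4, inner_neg_left] at h3
    rw [← inner_self_eq_zero (𝕜 := ℂ)]
    nth_rewrite 2 [← hp]
    rw [inner_add_right, ← h3, add_neg_cancel]
  have hux : u = x := sub_eq_zero.1 hu
  subst hux
  rwa [add_left_cancel hsum] at hxy

end Graph

section Factorization

variable {H : Type*} [NormedAddCommGroup H] [InnerProductSpace ℂ H] [CompleteSpace H]

/-- The adjoint of `A ∘ B` is `B ∘ A` for `A` bounded and `A`, `B` selfadjoint. -/
lemma mem_adjoint_graph_iff_of_factor {T B : H →ₗ.[ℂ] H} {A : H →L[ℂ] H}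
    (hTd : Dense (T.domain : Set H)) (hBd : Dense (B.domain : Set H)) (hB : B.adjoint = B)
    (hA : ∀ x y, ⟪A x, y⟫ = ⟪x, A y⟫)
    (hTB : ∀ x y, (x, y) ∈ T.graph ↔ ∃ z, (x, z) ∈ B.graph ∧ A z = y) {u w : H} :
    (u, w) ∈ T.adjoint.graph ↔ (A u, w) ∈ B.graph := by
  rw [mem_adjoint_graph_iff hTd]
  conv_rhs => rw [← hB, mem_adjoint_graph_iff hBd]
  constructor
  · intro h x y hxy
    rw [hA]
    exact h x _ ((hTB _ _).2 ⟨y, hxy, rfl⟩)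
  · intro h x y hxy
    obtain ⟨z, hxz, rfl⟩ := (hTB _ _).1 hxy
    rw [← hA]
    exact h x z hxz

/-- If `R ∘ B` is closed with `B` selfadjoint and `R` bounded selfadjoint, then
`1 + B R R B` is onto. -/
lemma exists_graph_add_eq {B : H →ₗ.[ℂ] H} {R : H →L[ℂ] H} (hBd : Dense (B.domain : Set H))
    (hB : B.adjoint = B) (hR : ∀ x y, ⟪R x, y⟫ = ⟪x, R y⟫)
    (hcl : IsClosed {p : H × H | ∃ y, (p.1, y) ∈ B.graph ∧ R y = p.2}) (z : H) :
    ∃ x y w, (x, y) ∈ B.graph ∧ (R (R y), w) ∈ B.graph ∧ x + w = z := by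
  let G : Submodule ℂ (WithLp 2 (H × H)) :=
    (B.graph.map (LinearMap.prodMap LinearMap.id (R : H →ₗ[ℂ] H))).comap
      (WithLp.linearEquiv 2 ℂ (H × H)).toLinearMap
  have hmem : ∀ p : WithLp 2 (H × H), p ∈ G ↔ ∃ y, (p.fst, y) ∈ B.graph ∧ R y = p.snd := by
    intro p
    simp only [G, Submodule.mem_comap, Submodule.mem_map]
    constructor
    · rintro ⟨⟨a, y⟩, h, h'⟩
      have h1 : a = p.fst := congrArg Prod.fst h'
      have h2 : R y = p.snd := congrArg Prod.snd h'
      exact ⟨y, h1 ▸ h, h2⟩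
    · rintro ⟨y, h, h'⟩
      exact ⟨(p.fst, y), h, Prod.ext rfl h'⟩
  have hGcl : IsClosed (G : Set (WithLp 2 (H × H))) := by
    have : (G : Set (WithLp 2 (H × H))) = WithLp.ofLp ⁻¹'
        {p : H × H | ∃ y, (p.1, y) ∈ B.graph ∧ R y = p.2} := Set.ext hmem
    rw [this]
    exact hcl.preimage (WithLp.prod_continuous_ofLp _ _ _)
  have : CompleteSpace G := hGcl.completeSpace_coe
  obtain ⟨p, hp, q, hq, hpq⟩ := G.exists_add_mem_mem_orthogonal (WithLp.toLp 2 (z, 0))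
  obtain ⟨y, hy, hy'⟩ := (hmem p).1 hp
  have hq1 : q.fst = z - p.fst := by
    have := congrArg WithLp.fst hpq
    simp at this
    rw [this]; abel
  have hq2 : q.snd = - p.snd := by
    have := congrArg WithLp.snd hpq
    simp at this
    exact eq_neg_of_add_eq_zero_right this.symm
  refine ⟨p.fst, y, z - p.fst, hy, ?_, by abel⟩
  rw [← hB, mem_adjoint_graph_iff hBd]
  intro a b hab
  have := Submodule.inner_left_of_mem_orthogonal
    ((hmem (WithLp.toLp 2 (a, R b))).2 ⟨b, hab, rfl⟩) hq
  rw [WithLp.prod_inner_apply] at this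
  simp only [WithLp.ofLp_fst, WithLp.ofLp_snd, hq1, hq2, inner_neg_left] at this
  rw [hR, hy']
  exact sub_eq_zero.1 ((sub_eq_add_neg _ _).trans this)

/-- If `T = A ∘ B` is closed with `A` positive of dense range, then `T* ∘ B` is selfadjoint as soon
as it is densely defined. -/
lemma adjoint_pcomp_eq_self {T B : H →ₗ.[ℂ] H} {A R : H →L[ℂ] H} (hT : T.IsClosed)
    (hTd : Dense (T.domain : Set H)) (hBd : Dense (B.domain : Set H)) (hB : B.adjoint = B)
    (hR : ∀ x y, ⟪R x, y⟫ = ⟪x, R y⟫) (hRA : ∀ x, R (R x) = A x) (hAr : DenseRange A)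
    (hTB : ∀ x y, (x, y) ∈ T.graph ↔ ∃ z, (x, z) ∈ B.graph ∧ A z = y)
    (hCd : Dense ((pcomp T.adjoint B).domain : Set H)) :
    (pcomp T.adjoint B).adjoint = pcomp T.adjoint B := by
  have hA : ∀ x y, ⟪A x, y⟫ = ⟪x, A y⟫ := fun x y => by rw [← hRA, ← hRA, hR, hR]
  have hRinj : ∀ x, R x = 0 → x = 0 := fun x hx => by
    refine hAr.eq_zero_of_inner_left ℂ fun y => ?_
    rw [← hA, ← hRA, hx, map_zero, inner_zero_left]
  have hC : ∀ x w, (x, w) ∈ (pcomp T.adjoint B).graph ↔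
      ∃ y, (x, y) ∈ B.graph ∧ (A y, w) ∈ B.graph := fun x w => by
    simp only [mem_pcomp_graph_iff, mem_adjoint_graph_iff_of_factor hTd hBd hB hA hTB]
  have hBsymm : ∀ u w x y, (u, w) ∈ B.graph → (x, y) ∈ B.graph → ⟪w, x⟫ = ⟪u, y⟫ :=
    fun u w x y h h' => (mem_adjoint_graph_iff hBd).1 (hB.symm ▸ h) x y h'
  have hcl : IsClosed {p : H × H | ∃ y, (p.1, y) ∈ B.graph ∧ R y = p.2} := by
    have : {p : H × H | ∃ y, (p.1, y) ∈ B.graph ∧ R y = p.2} =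
        (fun p : H × H => (p.1, R p.2)) ⁻¹' (T.graph : Set (H × H)) := by
      ext p
      simp only [Set.mem_ofPred_eq, Set.mem_preimage, SetLike.mem_coe, hTB]
      refine exists_congr fun z => and_congr_right fun _ => ?_
      rw [← hRA]
      refine ⟨congrArg R, fun h => sub_eq_zero.1 (hRinj _ ?_)⟩
      rw [map_sub, h, sub_self]
    rw [this]
    exact IsClosed.preimage (by fun_prop) hT
  refine adjoint_eq_self_of_add_surjective hCd (LinearPMap.le_of_le_graph ?_) fun z => ?_
  · rintro ⟨x, w⟩ hxw
    obtain ⟨y, hxy, hyw⟩ := (hC _ _).1 hxw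
    refine (mem_adjoint_graph_iff hCd).2 fun x' w' hxw' => ?_
    obtain ⟨y', hxy', hyw'⟩ := (hC _ _).1 hxw'
    rw [hBsymm _ _ _ _ hyw hxy', hA, hBsymm _ _ _ _ hxy hyw']
  · obtain ⟨x, y, w, hxy, hyw, hz⟩ := exists_graph_add_eq hBd hB hR hcl z
    exact ⟨x, w, (hC _ _).2 ⟨y, hxy, hRA y ▸ hyw⟩, hz⟩

end Factorization

/-- for a closed densely defined `T` with dense range, the Sebestyén inequality
`T*T ≤ λ T*B` with `dom B ⊆ dom T ⊆ dom (closure (B ↾ dom (T*∘B)))` for some nonnegative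
selfadjoint `B` with `T* ∘ B` selfadjoint holds iff `T = A ∘ B ∈ L²₊` with `A ∈ L⁺(H)` of dense
range and `B = closure (B ↾ dom (T*∘B))` nonnegative selfadjoint. -/
theorem statement10
    {H : Type*} [NormedAddCommGroup H] [InnerProductSpace ℂ H] [CompleteSpace H]
    (T : H →ₗ.[ℂ] H) (hT : T.IsClosed) (hTd : Dense (T.domain : Set H))
    (hTr : Dense (Set.range fun x : T.domain => T x)) :
    (∃ (lam : ℝ) (B : H →ₗ.[ℂ] H), 0 ≤ lam ∧ IsNonnegSelfAdjoint B ∧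
        IsSelfAdjointPMap (pcomp T.adjoint B) ∧
        B.domain ≤ T.domain ∧
        T.domain ≤ (B.domRestrict (pcomp T.adjoint B).domain).closure.domain ∧
        ∀ (x : H) (hxB : x ∈ B.domain), B ⟨x, hxB⟩ ∈ T.adjoint.domain →
          ∀ hxT : x ∈ T.domain,
            ‖T ⟨x, hxT⟩‖ ^ 2 ≤ lam * (⟪B ⟨x, hxB⟩, T ⟨x, hxT⟩⟫).re) ↔
    (∃ (A : H →L[ℂ] H) (B : H →ₗ.[ℂ] H), A.IsPositive ∧ DenseRange A ∧
        IsNonnegSelfAdjoint B ∧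
        B = (B.domRestrict (pcomp T.adjoint B).domain).closure ∧
        ∃ hdom : B.domain = T.domain,
          ∀ x : B.domain, T ⟨(x : H), hdom ▸ x.2⟩ = A (B x)) := by
  constructor
  · rintro ⟨lam, B, hlam, ⟨hBd, hBs, hBpos⟩, ⟨hCd, hCs⟩, hBT, hTB, hineq⟩
    have hBcl : B.IsClosed := IsSelfAdjoint.isClosed hBs
    have hcl : (B.domRestrict (pcomp T.adjoint B).domain).IsClosable :=
      hBcl.isClosable.leIsClosable LinearPMap.domRestrict_le
    have hle : (B.domRestrict (pcomp T.adjoint B).domain).closure ≤ B := by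
      refine LinearPMap.le_of_le_graph ?_
      rw [← hcl.graph_closure_eq_closure_graph]
      exact Submodule.topologicalClosure_minimal _
        (LinearPMap.le_graph_of_le LinearPMap.domRestrict_le) hBcl
    have hdom : B.domain = T.domain := le_antisymm hBT (hTB.trans hle.1)
    have hBeq : B = (B.domRestrict (pcomp T.adjoint B).domain).closure :=
      (LinearPMap.eq_of_le_of_domain_eq hle (le_antisymm hle.1 (hBT.trans hTB))).symm
    have hDB : (pcomp T.adjoint B).domain ≤ B.domain :=
      fun x hx => (mem_pcomp_domain_iff.1 hx).1
    have hDT : ∀ x : (pcomp T.adjoint B).domain, B ⟨x, hDB x.2⟩ ∈ T.adjoint.domain :=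
      fun x => (mem_pcomp_domain_iff.1 x.2).2
    have hBTinner : ∀ x y : (pcomp T.adjoint B).domain,
        ⟪B ⟨x, hDB x.2⟩, T ⟨y, hBT (hDB y.2)⟩⟫ = ⟪pcomp T.adjoint B x, (y : H)⟫ :=
      fun x y => by
        rw [pcomp_apply x (hDB x.2) (hDT x)]
        exact (LinearPMap.adjoint_isFormalAdjoint hTd ⟨_, hDT x⟩ ⟨y, hBT (hDB y.2)⟩).symm
    have hCsymm : ∀ x y : (pcomp T.adjoint B).domain,
        ⟪pcomp T.adjoint B x, (y : H)⟫ = ⟪(x : H), pcomp T.adjoint B y⟫ := fun x y => by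
      have hx : ((x : H), pcomp T.adjoint B x) ∈ (pcomp T.adjoint B).adjoint.graph :=
        hCs.symm ▸ (pcomp T.adjoint B).mem_graph x
      exact (mem_adjoint_graph_iff hCd).1 hx _ _ ((pcomp T.adjoint B).mem_graph y)
    obtain ⟨A, hA, hAB⟩ := exists_isPositive_apply_eq
      (B.toFun ∘ₗ Submodule.inclusion hDB) (T.toFun ∘ₗ Submodule.inclusion (hDB.trans hBT))
      (fun x y => by
        refine (hBTinner x y).trans ((hCsymm x y).trans ?_)
        rw [← inner_conj_symm, ← hBTinner y x, inner_conj_symm]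
        rfl) hlam
      (fun x => hineq x (hDB x.2) (hDT x) (hBT (hDB x.2)))
    have hgraph : B.graph ≤ T.graph.comap (LinearMap.prodMap LinearMap.id (A : H →ₗ[ℂ] H)) := by
      rw [graph_eq_topologicalClosure_of_eq_closure hBcl hBeq]
      refine Submodule.topologicalClosure_minimal _ ?_
        (IsClosed.preimage (f := fun p : H × H => (p.1, A p.2)) (by fun_prop) hT)
      rintro ⟨x, y⟩ hxy
      obtain ⟨hx, hxy⟩ := mem_domRestrict_graph_iff.1 hxy
      obtain ⟨⟨x, hxB⟩, rfl, rfl⟩ := (LinearPMap.mem_graph_iff _).1 hxy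
      have h : A (B ⟨x, hxB⟩) = T ⟨x, hBT hxB⟩ := hAB ⟨x, hx⟩
      change (x, A (B ⟨x, hxB⟩)) ∈ T.graph
      rw [h]
      exact T.mem_graph ⟨x, hBT hxB⟩
    have hTA : ∀ x : B.domain, T ⟨(x : H), hdom ▸ x.2⟩ = A (B x) := fun x =>
      LinearPMap.mem_graph_snd_inj _ (T.mem_graph ⟨(x : H), hdom ▸ x.2⟩)
        (hgraph (B.mem_graph x)) rfl
    refine ⟨A, B, hA, hTr.mono ?_, ⟨hBd, hBs, hBpos⟩, hBeq, hdom, hTA⟩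
    rintro _ ⟨x, rfl⟩
    exact ⟨B ⟨x, hdom.ge x.2⟩, (hTA ⟨x, hdom.ge x.2⟩).symm⟩
  · rintro ⟨A, B, hA, hAr, ⟨hBd, hBs, hBpos⟩, hBeq, hdom, hTA⟩
    have hBcl : B.IsClosed := IsSelfAdjoint.isClosed hBs
    have hA0 : 0 ≤ A := (ContinuousLinearMap.nonneg_iff_isPositive A).2 hA
    let R : H →L[ℂ] H := CFC.sqrt A
    have hRpos : R.IsPositive :=
      (ContinuousLinearMap.nonneg_iff_isPositive R).1 (CFC.sqrt_nonneg A)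
    have hR : ∀ x y, ⟪R x, y⟫ = ⟪x, R y⟫ := hRpos.isSymmetric
    have hRA : ∀ x, R (R x) = A x := fun x => by
      rw [← mul_apply_eq_comp, CFC.sqrt_mul_sqrt_self A hA0]
    have hTB : ∀ x y, (x, y) ∈ T.graph ↔ ∃ z, (x, z) ∈ B.graph ∧ A z = y := by
      intro x y
      constructor
      · intro h
        obtain ⟨⟨x, hx⟩, rfl, rfl⟩ := (LinearPMap.mem_graph_iff _).1 h
        exact ⟨B ⟨x, hdom.ge hx⟩, B.mem_graph ⟨x, hdom.ge hx⟩, (hTA ⟨x, hdom.ge hx⟩).symm⟩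
      · rintro ⟨z, h, rfl⟩
        obtain ⟨x, rfl, rfl⟩ := (LinearPMap.mem_graph_iff _).1 h
        rw [← hTA]
        exact T.mem_graph ⟨x, hdom ▸ x.2⟩
    have hCd : Dense ((pcomp T.adjoint B).domain : Set H) := by
      refine dense_closure.1 (hBd.mono fun x hx => ?_)
      have hmem : (x, B ⟨x, hx⟩) ∈ closure
          (((B.domRestrict (pcomp T.adjoint B).domain).graph : Submodule ℂ (H × H)) :
            Set (H × H)) := by
        rw [← Submodule.topologicalClosure_coe,
          ← graph_eq_topologicalClosure_of_eq_closure hBcl hBeq]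
        exact B.mem_graph ⟨x, hx⟩
      exact map_mem_closure continuous_fst hmem
        fun p hp => (mem_domRestrict_graph_iff.1 hp).1
    refine ⟨‖R‖ ^ 2, B, by positivity, ⟨hBd, hBs, hBpos⟩,
      ⟨hCd, adjoint_pcomp_eq_self hT hTd hBd hBs hR hRA hAr hTB hCd⟩, hdom.le,
      hdom ▸ hBeq ▸ le_rfl, fun x hxB _ hxT => ?_⟩
    have h : T ⟨x, hxT⟩ = R (R (B ⟨x, hxB⟩)) := (hTA ⟨x, hxB⟩).trans (hRA _).symm
    rw [h, ← hR, ← RCLike.re_eq_complex_re, inner_self_eq_norm_sq, ← mul_pow]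
    gcongr
    exact R.le_opNorm _
end
end
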